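/- Let Q=(0,1)² and fix a constant M>2. The set A := {f ∈ X : there exists E ⊆ Q with Lebesgue measure |E| = 0 and |f(E)| = 1} is residual in the metric space (X,d): there exists a countable family of subsets of X, each of which is open and dense with respect to d, whose intersection is contained in A. -/

import Mathlib

open MeasureTheory Set
open scoped ENNReal

noncomputable section

abbrev Plane := EuclideanSpace ℝ (Fin 2)

/-- The open unit square `(0,1)²`. -/
def unitSq : Set Plane := {x | 0 < x 0 ∧ x 0 < 1 ∧ 0 < x 1 ∧ x 1 < 1}

/-- Standard basis vectors of the plane. -/
def e2 (i : Fin 2) : Plane := EuclideanSpace.single i 1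

/-- The set of approximating values in the definition of the variation of `f` on `U`:
integrals against `C¹_c` test fields `φ = (φ₁, φ₂)` all of whose four components are
bounded by `1` in absolute value. -/
def varSet (f : Plane → Plane) (U : Set Plane) : Set ℝ :=
  {v | ∃ φ : Plane → Plane × Plane,
    ContDiff ℝ 1 φ ∧ HasCompactSupport φ ∧ tsupport φ ⊆ U ∧
    (∀ x i, |(φ x).1 i| ≤ 1 ∧ |(φ x).2 i| ≤ 1) ∧
    v = ∫ x in U, ((f x 0) * (fderiv ℝ (fun y => (φ y).1 0) x (e2 0)
                    + fderiv ℝ (fun y => (φ y).1 1) x (e2 1))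
        + (f x 1) * (fderiv ℝ (fun y => (φ y).2 0) x (e2 0)
                    + fderiv ℝ (fun y => (φ y).2 1) x (e2 1)))}

/-- The variation of `f` in `U`. -/
def Var (f : Plane → Plane) (U : Set Plane) : ℝ := sSup (varSet f U)

/-- `f` is a `BV` map on `U`. -/
def IsBV (f : Plane → Plane) (U : Set Plane) : Prop :=
  IntegrableOn f U volume ∧ BddAbove (varSet f U)

/-- `f` is a homeomorphism of `U` onto `V`, with inverse `g`. -/
def IsHomeoOn (f g : Plane → Plane) (U V : Set Plane) : Prop :=
  BijOn f U V ∧ ContinuousOn f U ∧ InvOn g f U V ∧ ContinuousOn g V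

/-- `f` (as a total function, representing its own continuous extension) extends
continuously to the closure of the unit square, with `f = Id` on the boundary. -/
def ExtendsToId (f : Plane → Plane) : Prop :=
  ContinuousOn f (closure unitSq) ∧ EqOn f id (frontier unitSq)

/-- The space `X` of `BV` homeomorphisms of the unit square fixing the boundary with
variation smaller than `M`; an element is a pair (homeomorphism, inverse). -/
def X (M : ℝ) : Set ((Plane → Plane) × (Plane → Plane)) :=
  {p | IsHomeoOn p.1 p.2 unitSq unitSq ∧ ExtendsToId p.1 ∧
    IsBV p.1 unitSq ∧ Var p.1 unitSq < M}

/-- Sup distance `‖f - g‖_∞` over the set `U`. -/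
def supDist (f g : Plane → Plane) (U : Set Plane) : ℝ := ⨆ x : U, dist (f x) (g x)

/-- The distance `d` on `X`. -/
def dX (M : ℝ) (p q : (Plane → Plane) × (Plane → Plane)) : ℝ :=
  supDist p.1 q.1 unitSq + supDist p.2 q.2 unitSq +
    |1 / (M - Var p.1 unitSq) - 1 / (M - Var q.1 unitSq)|

/-- `A` is open in the metric space `(X, d)`. -/
def OpenInX (M : ℝ) (A : Set ((Plane → Plane) × (Plane → Plane))) : Prop :=
  A ⊆ X M ∧ ∀ p ∈ A, ∃ ε > 0, ∀ q ∈ X M, dX M p q < ε → q ∈ A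

/-- `A` is dense in the metric space `(X, d)`. -/
def DenseInX (M : ℝ) (A : Set ((Plane → Plane) × (Plane → Plane))) : Prop :=
  A ⊆ X M ∧ ∀ p ∈ X M, ∀ ε > 0, ∃ q ∈ A, dX M p q < ε

/-- An open triangle in the plane. -/
def IsOpenTriangle (T : Set Plane) : Prop :=
  ∃ a b c : Plane, T = interior (convexHull ℝ {a, b, c})

/-- A finite union of pairwise disjoint open triangles. -/
def FinUnionTriangles (E : Set Plane) : Prop :=
  ∃ (k : ℕ) (T : Fin k → Set Plane), (∀ i, IsOpenTriangle (T i)) ∧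
    (∀ i j, i ≠ j → Disjoint (T i) (T j)) ∧ E = ⋃ i, T i

/-- The set `A` of homeomorphisms mapping a null set onto a set of full measure. -/
def Afull (M : ℝ) : Set ((Plane → Plane) × (Plane → Plane)) :=
  {p ∈ X M | ∃ E ⊆ unitSq, volume E = 0 ∧ volume (p.1 '' E) = 1}

/-- The set `A_n`. -/
def An (M : ℝ) (n : ℕ) : Set ((Plane → Plane) × (Plane → Plane)) :=
  {p ∈ X M | ∃ E ⊆ unitSq, FinUnionTriangles E ∧
    volume E < 1 / (n : ℝ≥0∞) ∧ 1 - 1 / (n : ℝ≥0∞) < volume (p.1 '' E)}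

/-- Data defining a vertical shear-type diffeomorphism of the plane that interpolates between the
identity and `(x, y) ↦ (x, k y)`, the interpolation being governed by the cut-off `χ x`. -/
structure ShearData where
  χ : ℝ → ℝ
  dχ : ℝ → ℝ
  k : ℝ → ℝ
  w : ℝ → ℝ
  δ : ℝ
  hasDerivAt_χ : ∀ x, HasDerivAt χ (dχ x) x
  contDiff_dχ : ContDiff ℝ 1 dχ
  hasDerivAt_k : ∀ y, HasDerivAt k (w y) y
  contDiff_w : ContDiff ℝ 1 w
  χ_nonneg : ∀ x, 0 ≤ χ x
  χ_le_one : ∀ x, χ x ≤ 1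
  χ_left : ∀ x ≤ 0, χ x = 0
  χ_right : ∀ x, 1 ≤ x → χ x = 0
  δ_pos : 0 < δ
  δ_le_one : δ ≤ 1
  δ_le_w : ∀ y, δ ≤ w y
  k_zero : k 0 = 0
  k_one : k 1 = 1

namespace ShearData

variable (D : ShearData)

/-- The second component of the map. -/
def col (x y : ℝ) : ℝ := y + D.χ x * (D.k y - y)

/-- The Jacobian determinant. -/
def jac (x y : ℝ) : ℝ := 1 + D.χ x * (D.w y - 1)

/-- The horizontal derivative of the second component. -/
def slope (x y : ℝ) : ℝ := D.dχ x * (D.k y - y)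

lemma δ_le_jac (x y : ℝ) : D.δ ≤ D.jac x y := by
  have h1 := D.χ_nonneg x
  have h2 := D.χ_le_one x
  have h3 := D.δ_le_w y
  have h4 := D.δ_le_one
  unfold jac
  nlinarith

lemma jac_pos (x y : ℝ) : 0 < D.jac x y := D.δ_pos.trans_le (D.δ_le_jac x y)

lemma hasDerivAt_col (x y : ℝ) : HasDerivAt (D.col x) (D.jac x y) y := by
  have := (hasDerivAt_id y).add (((D.hasDerivAt_k y).sub (hasDerivAt_id y)).const_mul (D.χ x))
  exact this

lemma monotone_col_sub (x : ℝ) : Monotone fun y => D.col x y - D.δ * y := by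
  have h : ∀ y, HasDerivAt (fun y => D.col x y - D.δ * y) (D.jac x y - D.δ * 1) y := fun y =>
    (D.hasDerivAt_col x y).sub ((hasDerivAt_id y).const_mul D.δ)
  refine monotone_of_deriv_nonneg (fun y => (h y).differentiableAt) fun y => ?_
  rw [(h y).deriv]
  linarith [D.δ_le_jac x y]

lemma strictMono_col (x : ℝ) : StrictMono (D.col x) := by
  intro a b hab
  have h1 := D.monotone_col_sub x hab.le
  have h2 := mul_lt_mul_of_pos_left hab D.δ_pos
  simp only at h1
  linarith

lemma continuous_k : Continuous D.k :=
  continuous_iff_continuousAt.2 fun y => (D.hasDerivAt_k y).continuousAt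

lemma continuous_χ : Continuous D.χ :=
  continuous_iff_continuousAt.2 fun y => (D.hasDerivAt_χ y).continuousAt

lemma col_zero (x : ℝ) : D.col x 0 = 0 := by simp [col, D.k_zero]

lemma col_one (x : ℝ) : D.col x 1 = 1 := by simp [col, D.k_one]

lemma surjective_col (x : ℝ) : Function.Surjective (D.col x) := by
  have hc : Continuous (D.col x) := by
    have := D.continuous_k
    unfold col
    fun_prop
  refine hc.surjective ?_ ?_
  · refine Filter.tendsto_atTop_mono' _ (f₁ := fun y => D.δ * y) ?_
      (Filter.tendsto_id.const_mul_atTop D.δ_pos)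
    filter_upwards [Filter.eventually_ge_atTop 0] with y hy
    have := D.monotone_col_sub x hy
    simp only [col_zero] at this
    linarith
  · refine Filter.tendsto_atBot_mono' _ (f₁ := fun y => D.δ * y) ?_
      ((Filter.tendsto_const_mul_atBot_of_pos D.δ_pos).2 Filter.tendsto_id)
    filter_upwards [Filter.eventually_le_atBot 0] with y hy
    have := D.monotone_col_sub x hy
    simp only [col_zero] at this
    linarith

/-- The inverse of `col x`. -/
def colInv (x : ℝ) : ℝ → ℝ := Function.surjInv (D.surjective_col x)

lemma col_colInv (x y : ℝ) : D.col x (D.colInv x y) = y :=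
  Function.surjInv_eq (D.surjective_col x) y

lemma colInv_col (x y : ℝ) : D.colInv x (D.col x y) = y :=
  (D.strictMono_col x).injective (D.col_colInv x _)

/-- The diffeomorphism `(x, y) ↦ (x, col x y)`. -/
def map (p : Plane) : Plane := !₂[p 0, D.col (p 0) (p 1)]

/-- The inverse diffeomorphism. -/
def inv (p : Plane) : Plane := !₂[p 0, D.colInv (p 0) (p 1)]

@[simp] lemma map_apply_zero (p : Plane) : D.map p 0 = p 0 := rfl
@[simp] lemma map_apply_one (p : Plane) : D.map p 1 = D.col (p 0) (p 1) := rfl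
@[simp] lemma inv_apply_zero (p : Plane) : D.inv p 0 = p 0 := rfl
@[simp] lemma inv_apply_one (p : Plane) : D.inv p 1 = D.colInv (p 0) (p 1) := rfl

lemma _root_.plane_ext {p q : Plane} (h0 : p 0 = q 0) (h1 : p 1 = q 1) : p = q := by
  ext i
  fin_cases i
  · exact h0
  · exact h1

lemma inv_map (p : Plane) : D.inv (D.map p) = p :=
  plane_ext rfl (by simp [colInv_col])

lemma map_inv (p : Plane) : D.map (D.inv p) = p :=
  plane_ext rfl (by simp [col_colInv])

lemma continuous_map : Continuous D.map := by
  have h1 := D.continuous_k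
  have h2 := D.continuous_χ
  unfold map col
  fun_prop

lemma continuous_colInv : Continuous fun p : ℝ × ℝ => D.colInv p.1 p.2 := by
  have hc : ∀ z, Continuous fun x => D.col x z := fun z => by
    have h2 := D.continuous_χ
    unfold col
    fun_prop
  refine continuous_iff_continuousAt.2 fun p => ?_
  refine tendsto_order.2 ⟨fun a ha => ?_, fun a ha => ?_⟩
  · have h : D.col p.1 a < p.2 := by
      rw [← D.col_colInv p.1 p.2]; exact D.strictMono_col _ ha
    filter_upwards [(isOpen_lt ((hc a).comp continuous_fst) continuous_snd).mem_nhds h] with q hq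
    refine (D.strictMono_col q.1).lt_iff_lt.1 ?_
    rw [D.col_colInv]; exact hq
  · have h : p.2 < D.col p.1 a := by
      rw [← D.col_colInv p.1 p.2]; exact D.strictMono_col _ ha
    filter_upwards [(isOpen_lt continuous_snd ((hc a).comp continuous_fst)).mem_nhds h] with q hq
    refine (D.strictMono_col q.1).lt_iff_lt.1 ?_
    rw [D.col_colInv]; exact hq

lemma continuous_inv : Continuous D.inv := by
  have h : Continuous fun p : Plane => D.colInv (p 0) (p 1) :=
    D.continuous_colInv.comp (by fun_prop : Continuous fun p : Plane => (p 0, p 1))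
  unfold inv
  fun_prop

lemma map_mem_unitSq {p : Plane} : D.map p ∈ unitSq ↔ p ∈ unitSq := by
  have h0 : 0 < D.col (p 0) (p 1) ↔ 0 < p 1 := by
    simpa [D.col_zero] using (D.strictMono_col (p 0)).lt_iff_lt (a := 0) (b := p 1)
  have h1 : D.col (p 0) (p 1) < 1 ↔ p 1 < 1 := by
    simpa [D.col_one] using (D.strictMono_col (p 0)).lt_iff_lt (a := p 1) (b := 1)
  simp [unitSq, h0, h1]

lemma inv_mem_unitSq {p : Plane} : D.inv p ∈ unitSq ↔ p ∈ unitSq := by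
  rw [← D.map_mem_unitSq, D.map_inv]

lemma image_map_unitSq : D.map '' unitSq = unitSq := by
  ext p
  constructor
  · rintro ⟨q, hq, rfl⟩; exact D.map_mem_unitSq.2 hq
  · intro hp; exact ⟨D.inv p, D.inv_mem_unitSq.2 hp, D.map_inv p⟩

/-- The shear map as a homeomorphism of the plane. -/
def homeo : Plane ≃ₜ Plane where
  toFun := D.map
  invFun := D.inv
  left_inv := D.inv_map
  right_inv := D.map_inv
  continuous_toFun := D.continuous_map
  continuous_invFun := D.continuous_inv

lemma _root_.isOpen_unitSq : IsOpen unitSq := by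
  have h0 : Continuous fun p : Plane => p 0 := by fun_prop
  have h1 : Continuous fun p : Plane => p 1 := by fun_prop
  exact (isOpen_lt continuous_const h0).and ((isOpen_lt h0 continuous_const).and
    ((isOpen_lt continuous_const h1).and (isOpen_lt h1 continuous_const)))

lemma _root_.closure_unitSq_subset :
    closure unitSq ⊆ {x : Plane | 0 ≤ x 0 ∧ x 0 ≤ 1 ∧ 0 ≤ x 1 ∧ x 1 ≤ 1} := by
  have h0 : Continuous fun p : Plane => p 0 := by fun_prop
  have h1 : Continuous fun p : Plane => p 1 := by fun_prop
  refine closure_minimal (fun x hx => ⟨hx.1.le, hx.2.1.le, hx.2.2.1.le, hx.2.2.2.le⟩) ?_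
  exact (isClosed_le continuous_const h0).and ((isClosed_le h0 continuous_const).and
    ((isClosed_le continuous_const h1).and (isClosed_le h1 continuous_const)))

lemma map_of_mem_frontier {p : Plane} (hp : p ∈ frontier unitSq) : D.map p = p := by
  rw [isOpen_unitSq.frontier_eq] at hp
  obtain ⟨h1, h2, h3, h4⟩ := closure_unitSq_subset hp.1
  refine plane_ext rfl ?_
  rw [map_apply_one]
  by_cases a : p 0 ≤ 0
  · simp [col, D.χ_left _ a]
  by_cases b : 1 ≤ p 0
  · simp [col, D.χ_right _ b]
  by_cases c : p 1 ≤ 0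
  · rw [le_antisymm c h3, D.col_zero]
  by_cases d : 1 ≤ p 1
  · rw [le_antisymm h4 d, D.col_one]
  · push Not at a b c d
    exact absurd ⟨a, b, c, d⟩ hp.2

lemma inv_of_mem_frontier {p : Plane} (hp : p ∈ frontier unitSq) : D.inv p = p := by
  conv_lhs => rw [← D.map_of_mem_frontier hp]
  exact D.inv_map p

lemma mapsTo_inv_closure : MapsTo D.inv (closure unitSq) (closure unitSq) :=
  MapsTo.closure (fun _ hp => D.inv_mem_unitSq.2 hp) D.continuous_inv

lemma _root_.dist_eq_of_apply_zero_eq {p q : Plane} (h : p 0 = q 0) : dist p q = |p 1 - q 1| := by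
  rw [EuclideanSpace.dist_eq]
  simp [h, Real.dist_eq, Real.sqrt_sq_eq_abs]

lemma dist_map_le {r : ℝ} (hr : ∀ y, 0 ≤ y → y ≤ 1 → |D.k y - y| ≤ r) {p : Plane}
    (hp : p ∈ unitSq) : dist (D.map p) p ≤ r := by
  rw [dist_eq_of_apply_zero_eq (D.map_apply_zero p), map_apply_one, col, add_sub_cancel_left, abs_mul,
    abs_of_nonneg (D.χ_nonneg _)]
  have h := hr (p 1) hp.2.2.1.le hp.2.2.2.le
  exact (mul_le_of_le_one_left (abs_nonneg _) (D.χ_le_one _)).trans h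

lemma dist_inv_le {r : ℝ} (hr : ∀ y, 0 ≤ y → y ≤ 1 → |D.k y - y| ≤ r) {p : Plane}
    (hp : p ∈ unitSq) : dist (D.inv p) p ≤ r := by
  have := D.dist_map_le hr (D.inv_mem_unitSq.2 hp)
  rwa [D.map_inv, dist_comm] at this

/-- The derivative of the shear map. -/
def deriv (p : Plane) : Plane →L[ℝ] Plane :=
  LinearMap.toContinuousLinearMap
    (Matrix.toLin (EuclideanSpace.basisFun (Fin 2) ℝ).toBasis
      (EuclideanSpace.basisFun (Fin 2) ℝ).toBasis
      !![1, 0; D.slope (p 0) (p 1), D.jac (p 0) (p 1)])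

lemma det_deriv (p : Plane) : (D.deriv p).det = D.jac (p 0) (p 1) := by
  rw [ContinuousLinearMap.det, deriv, LinearMap.coe_toContinuousLinearMap, LinearMap.det_toLin,
    Matrix.det_fin_two_of]
  ring

lemma deriv_apply (p v : Plane) :
    D.deriv p v = !₂[v 0, D.slope (p 0) (p 1) * v 0 + D.jac (p 0) (p 1) * v 1] := by
  apply plane_ext <;>
  simp [deriv, Matrix.toLin_apply, Matrix.mulVec, dotProduct, Fin.sum_univ_two]

lemma hasFDerivAt_map (p : Plane) : HasFDerivAt D.map (D.deriv p) p := by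
  have e0 : HasFDerivAt (fun x : Plane => x 0) (EuclideanSpace.proj 0 : Plane →L[ℝ] ℝ) p :=
    (EuclideanSpace.proj 0 : Plane →L[ℝ] ℝ).hasFDerivAt
  have e1 : HasFDerivAt (fun x : Plane => x 1) (EuclideanSpace.proj 1 : Plane →L[ℝ] ℝ) p :=
    (EuclideanSpace.proj 1 : Plane →L[ℝ] ℝ).hasFDerivAt
  refine (hasFDerivWithinAt_univ.symm.trans hasFDerivWithinAt_euclidean).2 fun i => ?_
  fin_cases i
  · refine (hasFDerivWithinAt_univ.2 e0).congr_fderiv ?_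
    ext v
    simp [deriv_apply]
  · have h := e1.add (((D.hasDerivAt_χ (p 0)).comp_hasFDerivAt p e0).mul
      (((D.hasDerivAt_k (p 1)).comp_hasFDerivAt p e1).sub e1))
    refine (hasFDerivWithinAt_univ.2 h).congr_fderiv ?_
    ext v
    simp [deriv_apply, slope, jac]
    ring

end ShearData

/-- The divergence of a planar vector field. -/
def divg (η : Plane → Plane) (x : Plane) : ℝ :=
  fderiv ℝ (fun y => η y 0) x (e2 0) + fderiv ℝ (fun y => η y 1) x (e2 1)

/-- The pairing of `f` with the (row-wise) divergence of `φ` over the unit square. -/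
def pairing (f : Plane → Plane) (φ : Plane → Plane × Plane) : ℝ :=
  ∫ x in unitSq, (f x 0 * divg (fun y => (φ y).1) x + f x 1 * divg (fun y => (φ y).2) x)

/-- `C¹` test fields compactly supported in the unit square with all components bounded by `C`. -/
structure IsTestField (C : ℝ) (φ : Plane → Plane × Plane) : Prop where
  contDiff : ContDiff ℝ 1 φ
  hasCompactSupport : HasCompactSupport φ
  tsupport_subset : tsupport φ ⊆ unitSq
  bound : ∀ x i, |(φ x).1 i| ≤ C ∧ |(φ x).2 i| ≤ C

lemma mem_varSet_iff {f : Plane → Plane} {v : ℝ} :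
    v ∈ varSet f unitSq ↔ ∃ φ, IsTestField 1 φ ∧ v = pairing f φ := by
  constructor
  · rintro ⟨φ, h1, h2, h3, h4, h5⟩
    exact ⟨φ, ⟨h1, h2, h3, h4⟩, h5⟩
  · rintro ⟨φ, h, h5⟩
    exact ⟨φ, h.contDiff, h.hasCompactSupport, h.tsupport_subset, h.bound, h5⟩

lemma isCompact_closure_unitSq : IsCompact (closure unitSq) := by
  refine Metric.isCompact_of_isClosed_isBounded isClosed_closure
    ((Metric.isBounded_closedBall (x := (0 : Plane)) (r := 2)).subset fun x hx => ?_)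
  obtain ⟨h1, h2, h3, h4⟩ := closure_unitSq_subset hx
  rw [mem_closedBall_zero_iff, EuclideanSpace.norm_eq, Fin.sum_univ_two, Real.norm_eq_abs,
    Real.norm_eq_abs, sq_abs, sq_abs]
  apply Real.sqrt_le_iff.2
  constructor
  · norm_num
  · nlinarith

lemma contDiff_apply_comp {η : Plane → Plane} (h : ContDiff ℝ 1 η) (i : Fin 2) :
    ContDiff ℝ 1 fun y => η y i := contDiff_euclidean.1 h i

lemma continuous_divg {η : Plane → Plane} (h : ContDiff ℝ 1 η) : Continuous (divg η) := by
  have h0 := (contDiff_apply_comp h 0).continuous_fderiv one_ne_zero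
  have h1 := (contDiff_apply_comp h 1).continuous_fderiv one_ne_zero
  unfold divg
  fun_prop

lemma continuousOn_pairing {f : Plane → Plane} (hf : ContinuousOn f (closure unitSq))
    {φ : Plane → Plane × Plane} (hφ : ContDiff ℝ 1 φ) :
    ContinuousOn (fun x => f x 0 * divg (fun y => (φ y).1) x + f x 1 * divg (fun y => (φ y).2) x)
      (closure unitSq) := by
  have h1 := (continuous_divg hφ.fst).continuousOn (s := closure unitSq)
  have h2 := (continuous_divg hφ.snd).continuousOn (s := closure unitSq)
  have f0 : ContinuousOn (fun x => f x 0) (closure unitSq) := by fun_prop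
  have f1 : ContinuousOn (fun x => f x 1) (closure unitSq) := by fun_prop
  exact (f0.mul h1).add (f1.mul h2)

lemma integrableOn_pairing {f : Plane → Plane} (hf : ContinuousOn f (closure unitSq))
    {φ : Plane → Plane × Plane} (hφ : ContDiff ℝ 1 φ) :
    IntegrableOn (fun x => f x 0 * divg (fun y => (φ y).1) x + f x 1 * divg (fun y => (φ y).2) x)
      unitSq :=
  ((continuousOn_pairing hf hφ).integrableOn_compact isCompact_closure_unitSq).mono_set
    subset_closure

lemma divg_sum {ι : Type*} (s : Finset ι) {η : ι → Plane → Plane}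
    (h : ∀ i, ContDiff ℝ 1 (η i)) (x : Plane) :
    divg (fun y => ∑ i ∈ s, η i y) x = ∑ i ∈ s, divg (η i) x := by
  have d : ∀ j, ∀ i ∈ s, DifferentiableAt ℝ (fun y => η i y j) x := fun j i _ =>
    (contDiff_apply_comp (h i) j).differentiable one_ne_zero x
  have e : ∀ j : Fin 2, (fun y => (∑ i ∈ s, η i y) j) = fun y => ∑ i ∈ s, η i y j := by
    intro j; ext y; simp
  simp only [divg, e]
  rw [fderiv_fun_sum (d 0), fderiv_fun_sum (d 1)]
  simp [Finset.sum_add_distrib]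

lemma pairing_sum {ι : Type*} (s : Finset ι) {f : Plane → Plane}
    (hf : ContinuousOn f (closure unitSq)) {φ : ι → Plane → Plane × Plane}
    (hφ : ∀ i, ContDiff ℝ 1 (φ i)) :
    pairing f (fun x => ∑ i ∈ s, φ i x) = ∑ i ∈ s, pairing f (φ i) := by
  unfold pairing
  rw [← integral_finsetSum _ fun i _ => integrableOn_pairing hf (hφ i)]
  congr 1
  ext x
  simp only [Prod.fst_sum, Prod.snd_sum]
  rw [divg_sum s fun i => (hφ i).fst, divg_sum s fun i => (hφ i).snd, Finset.mul_sum,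
    Finset.mul_sum, Finset.sum_add_distrib]

lemma divg_smul (c : ℝ) {η : Plane → Plane} (h : ContDiff ℝ 1 η) (x : Plane) :
    divg (fun y => c • η y) x = c * divg η x := by
  have d : ∀ j, DifferentiableAt ℝ (fun y => η y j) x := fun j =>
    (contDiff_apply_comp h j).differentiable one_ne_zero x
  simp only [divg, PiLp.smul_apply, smul_eq_mul]
  rw [fderiv_const_mul (d 0), fderiv_const_mul (d 1)]
  simp [mul_add]

lemma pairing_smul (c : ℝ) (f : Plane → Plane) {φ : Plane → Plane × Plane}
    (hφ : ContDiff ℝ 1 φ) : pairing f (fun x => c • φ x) = c * pairing f φ := by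
  unfold pairing
  rw [← integral_const_mul]
  congr 1
  ext x
  simp only [Prod.smul_fst, Prod.smul_snd]
  rw [divg_smul c hφ.fst, divg_smul c hφ.snd]
  ring

lemma pairing_le_mul_Var {f : Plane → Plane} (hf : IsBV f unitSq) {C : ℝ} (hC : 0 < C)
    {φ : Plane → Plane × Plane} (hφ : IsTestField C φ) : pairing f φ ≤ C * Var f unitSq := by
  have h : pairing f (fun x => C⁻¹ • φ x) ∈ varSet f unitSq := by
    refine mem_varSet_iff.2 ⟨_, ⟨hφ.contDiff.const_smul C⁻¹, ?_, ?_, fun x i => ?_⟩, rfl⟩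
    · exact hφ.hasCompactSupport.smul_left (f := fun _ => C⁻¹)
    · exact (tsupport_smul_subset_right (fun _ => C⁻¹) φ).trans hφ.tsupport_subset
    · have := hφ.bound x i
      simp only [Prod.smul_fst, Prod.smul_snd, PiLp.smul_apply, smul_eq_mul, abs_mul, abs_inv,
        abs_of_pos hC]
      rw [inv_mul_le_one₀ hC, inv_mul_le_one₀ hC]
      exact this
  have h2 := le_csSup hf.2 h
  rw [pairing_smul _ _ hφ.contDiff, inv_mul_le_iff₀ hC] at h2
  exact h2

lemma zero_mem_varSet (f : Plane → Plane) : 0 ∈ varSet f unitSq := by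
  refine mem_varSet_iff.2 ⟨fun _ => 0, ⟨contDiff_const, HasCompactSupport.zero, ?_, ?_⟩, ?_⟩
  · simp [tsupport]
  · simp
  · simp [pairing, divg]

lemma Var_nonneg {f : Plane → Plane} (hf : BddAbove (varSet f unitSq)) : 0 ≤ Var f unitSq :=
  le_csSup hf (zero_mem_varSet f)

lemma measurableSet_unitSq : MeasurableSet unitSq := isOpen_unitSq.measurableSet

lemma volume_unitSq : volume unitSq = 1 := by
  have h : unitSq = WithLp.ofLp ⁻¹' (Set.pi univ fun _ : Fin 2 => Ioo (0 : ℝ) 1) := by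
    ext x
    simp [unitSq, Fin.forall_fin_two, and_assoc]
  rw [h, (PiLp.volume_preserving_ofLp (Fin 2)).measure_preimage
    (MeasurableSet.univ_pi fun _ => measurableSet_Ioo).nullMeasurableSet, volume_pi_pi]
  simp

/-- Lower semicontinuity of the variation under uniform convergence. -/
lemma exists_forall_lt_Var {f : Plane → Plane} (hf : ContinuousOn f (closure unitSq))
    {τ : ℝ} (hτ : 0 < τ) :
    ∃ r > 0, ∀ g : Plane → Plane, ContinuousOn g (closure unitSq) → IsBV g unitSq →
      (∀ x ∈ unitSq, dist (g x) (f x) ≤ r) → Var f unitSq - τ < Var g unitSq := by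
  obtain ⟨v, hv, hlt⟩ := exists_lt_of_lt_csSup ⟨0, zero_mem_varSet f⟩
    (show Var f unitSq - τ / 2 < sSup (varSet f unitSq) by unfold Var; linarith)
  obtain ⟨φ, hφ, rfl⟩ := mem_varSet_iff.1 hv
  have hc : ContinuousOn (fun x => |divg (fun y => (φ y).1) x| + |divg (fun y => (φ y).2) x|)
      (closure unitSq) :=
    ((continuous_divg hφ.contDiff.fst).abs.add (continuous_divg hφ.contDiff.snd).abs).continuousOn
  obtain ⟨B, hB⟩ := isCompact_closure_unitSq.exists_bound_of_continuousOn hc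
  have hB0 : 0 < |B| + 1 := by positivity
  refine ⟨τ / 2 / (|B| + 1) / 2, by positivity, fun g hg hgBV hd => ?_⟩
  have h1 : |pairing g φ - pairing f φ| ≤ τ / 2 / 2 := by
    unfold pairing
    rw [← integral_sub (integrableOn_pairing hg hφ.contDiff) (integrableOn_pairing hf hφ.contDiff),
      ← Real.norm_eq_abs]
    have := norm_setIntegral_le_of_norm_le_const (μ := (volume : Measure Plane)) (s := unitSq)
      (C := τ / 2 / 2) (f := fun x => (g x 0 * divg (fun y => (φ y).1) x +
        g x 1 * divg (fun y => (φ y).2) x) - (f x 0 * divg (fun y => (φ y).1) x +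
        f x 1 * divg (fun y => (φ y).2) x)) (by simp [volume_unitSq]) ?_
    · simpa [Measure.real, volume_unitSq] using this
    · intro x hx
      have hb := hB x (subset_closure hx)
      rw [Real.norm_eq_abs, abs_of_nonneg (by positivity)] at hb
      have hc : ∀ i, |g x i - f x i| ≤ τ / 2 / (|B| + 1) / 2 := fun i => by
        refine le_trans ?_ (hd x hx)
        rw [dist_eq_norm]
        exact PiLp.norm_apply_le (g x - f x) i
      set a := divg (fun y => (φ y).1) x
      set b := divg (fun y => (φ y).2) x
      have e : g x 0 * a + g x 1 * b - (f x 0 * a + f x 1 * b)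
          = (g x 0 - f x 0) * a + (g x 1 - f x 1) * b := by ring
      rw [e, Real.norm_eq_abs]
      calc _ ≤ |(g x 0 - f x 0) * a| + |(g x 1 - f x 1) * b| := abs_add_le _ _
        _ ≤ τ / 2 / (|B| + 1) / 2 * |a| + τ / 2 / (|B| + 1) / 2 * |b| := by
          rw [abs_mul, abs_mul]
          gcongr
          · exact hc 0
          · exact hc 1
        _ = τ / 2 / (|B| + 1) / 2 * (|a| + |b|) := by ring
        _ ≤ τ / 2 / (|B| + 1) / 2 * (|B| + 1) := by
          refine mul_le_mul_of_nonneg_left ?_ (by positivity)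
          linarith [le_abs_self B]
        _ = τ / 2 / 2 := by field_simp
  have h2 := pairing_le_mul_Var hgBV one_pos hφ
  have h3 := (abs_le.1 h1).1
  linarith

namespace ShearData

variable (D : ShearData)

/-- The Piola transform of a vector at a point. -/
def piola (x v : Plane) : Plane :=
  !₂[D.jac (x 0) (x 1) * v 0, v 1 - D.slope (x 0) (x 1) * v 0]

/-- The row-wise Piola pull-back of a test field. -/
def pull (φ : Plane → Plane × Plane) (x : Plane) : Plane × Plane :=
  (D.piola x (φ (D.map x)).1, D.piola x (φ (D.map x)).2)

lemma contDiff_χ : ContDiff ℝ 1 D.χ := by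
  refine contDiff_one_iff_deriv.2 ⟨fun x => (D.hasDerivAt_χ x).differentiableAt, ?_⟩
  rw [show _root_.deriv D.χ = D.dχ from funext fun x => (D.hasDerivAt_χ x).deriv]
  exact D.contDiff_dχ.continuous

lemma contDiff_k : ContDiff ℝ 1 D.k := by
  refine contDiff_one_iff_deriv.2 ⟨fun x => (D.hasDerivAt_k x).differentiableAt, ?_⟩
  rw [show _root_.deriv D.k = D.w from funext fun x => (D.hasDerivAt_k x).deriv]
  exact D.contDiff_w.continuous

lemma contDiff_map : ContDiff ℝ 1 D.map := by
  have h1 := D.contDiff_χ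
  have h2 := D.contDiff_k
  refine contDiff_euclidean.2 fun i => ?_
  fin_cases i
  · simp only [map, Fin.zero_eta, PiLp.toLp_apply, Matrix.cons_val_zero]
    fun_prop
  · simp only [map, col, Fin.mk_one, PiLp.toLp_apply, Matrix.cons_val_one, Matrix.cons_val_fin_one]
    fun_prop

lemma contDiff_piola {η : Plane → Plane} (h : ContDiff ℝ 1 η) :
    ContDiff ℝ 1 fun x => D.piola x (η x) := by
  have h1 := D.contDiff_χ
  have h2 := D.contDiff_k
  have h3 := D.contDiff_w
  have h4 := D.contDiff_dχ
  have h5 := contDiff_apply_comp h 0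
  have h6 := contDiff_apply_comp h 1
  refine contDiff_euclidean.2 fun i => ?_
  fin_cases i
  · simp only [piola, jac, Fin.zero_eta, PiLp.toLp_apply, Matrix.cons_val_zero]
    fun_prop
  · simp only [piola, slope, Fin.mk_one, PiLp.toLp_apply, Matrix.cons_val_one,
      Matrix.cons_val_fin_one]
    fun_prop

lemma contDiff_pull {φ : Plane → Plane × Plane} (hφ : ContDiff ℝ 1 φ) :
    ContDiff ℝ 1 (D.pull φ) :=
  (D.contDiff_piola (hφ.fst.comp D.contDiff_map)).prodMk
    (D.contDiff_piola (hφ.snd.comp D.contDiff_map))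

lemma divg_piola {η : Plane → Plane} (h : ContDiff ℝ 1 η) (x : Plane) :
    divg (fun y => D.piola y (η (D.map y))) x = D.jac (x 0) (x 1) * divg η (D.map x) := by
  have e0 : HasFDerivAt (fun x : Plane => x 0) (EuclideanSpace.proj 0 : Plane →L[ℝ] ℝ) x :=
    (EuclideanSpace.proj 0 : Plane →L[ℝ] ℝ).hasFDerivAt
  have e1 : HasFDerivAt (fun x : Plane => x 1) (EuclideanSpace.proj 1 : Plane →L[ℝ] ℝ) x :=
    (EuclideanSpace.proj 1 : Plane →L[ℝ] ℝ).hasFDerivAt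
  have hη : ∀ i, HasFDerivAt (fun y => η (D.map y) i)
      ((fderiv ℝ (fun y => η y i) (D.map x)).comp (D.deriv x)) x := fun i =>
    ((contDiff_apply_comp h i).differentiable one_ne_zero _).hasFDerivAt.comp x
      (D.hasFDerivAt_map x)
  have hw := (D.contDiff_w.differentiable one_ne_zero (x 1)).hasDerivAt
  have hd := (D.contDiff_dχ.differentiable one_ne_zero (x 0)).hasDerivAt
  have hJ := (((D.hasDerivAt_χ (x 0)).comp_hasFDerivAt x e0).mul
    ((hw.comp_hasFDerivAt x e1).sub_const 1)).const_add 1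
  have hS := (hd.comp_hasFDerivAt x e0).mul
    (((D.hasDerivAt_k (x 1)).comp_hasFDerivAt x e1).sub e1)
  have E0 : HasFDerivAt (fun y => D.piola y (η (D.map y)) 0) _ x := hJ.mul (hη 0)
  have E1 : HasFDerivAt (fun y => D.piola y (η (D.map y)) 1) _ x := (hη 1).sub (hS.mul (hη 0))
  have v0 : D.deriv x (e2 0) = e2 0 + D.slope (x 0) (x 1) • e2 1 := by
    rw [deriv_apply]; apply plane_ext <;> simp [e2]
  have v1 : D.deriv x (e2 1) = D.jac (x 0) (x 1) • e2 1 := by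
    rw [deriv_apply]; apply plane_ext <;> simp [e2]
  unfold divg
  rw [E0.fderiv, E1.fderiv]
  simp only [add_apply, sub_apply,
    smul_apply, ContinuousLinearMap.comp_apply, v0, v1, map_add, map_smul,
    smul_eq_mul, Function.comp_apply]
  simp [e2, slope, jac]
  ring

lemma pairing_comp_inv (f : Plane → Plane) {φ : Plane → Plane × Plane} (hφ : ContDiff ℝ 1 φ) :
    pairing (f ∘ D.inv) φ = pairing f (D.pull φ) := by
  unfold pairing
  conv_lhs => rw [← D.image_map_unitSq]
  rw [integral_image_eq_integral_abs_det_fderiv_smul volume measurableSet_unitSq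
    (fun x _ => (D.hasFDerivAt_map x).hasFDerivWithinAt)
    (Function.LeftInverse.injective D.inv_map).injOn]
  congr 1
  ext x
  have h1 := D.divg_piola hφ.fst x
  have h2 := D.divg_piola hφ.snd x
  simp only [pull]
  rw [h1, h2, D.det_deriv, abs_of_pos (D.jac_pos _ _)]
  simp only [Function.comp_apply, D.inv_map, smul_eq_mul]
  ring

lemma pull_eq_zero {φ : Plane → Plane × Plane} {x : Plane} (h : φ (D.map x) = 0) :
    D.pull φ x = 0 := by
  have : D.piola x 0 = 0 := by apply plane_ext <;> simp [piola]
  simp [pull, h, this]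

lemma tsupport_pull_subset {φ : Plane → Plane × Plane} :
    tsupport (D.pull φ) ⊆ D.map ⁻¹' tsupport φ := by
  refine closure_minimal (fun x hx => ?_) ((isClosed_tsupport φ).preimage D.continuous_map)
  refine subset_tsupport φ fun h => hx (D.pull_eq_zero h)

lemma hasCompactSupport_pull {φ : Plane → Plane × Plane} (h : HasCompactSupport φ) :
    HasCompactSupport (D.pull φ) :=
  (D.homeo.isCompact_preimage.2 h).of_isClosed_subset (isClosed_tsupport _) D.tsupport_pull_subset

lemma tsupport_pull_subset_unitSq {φ : Plane → Plane × Plane} (h : tsupport φ ⊆ unitSq) :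
    tsupport (D.pull φ) ⊆ unitSq := fun _ hx =>
  D.map_mem_unitSq.1 (h (D.tsupport_pull_subset hx))

end ShearData

lemma bddAbove_and_sum_sSup_le {ι : Type*} [Fintype ι] {S : ι → Set ℝ} (h0 : ∀ i, 0 ∈ S i) {B : ℝ}
    (h : ∀ v : ι → ℝ, (∀ i, v i ∈ S i) → ∑ i, v i ≤ B) :
    (∀ i, BddAbove (S i)) ∧ ∑ i, sSup (S i) ≤ B := by
  classical
  constructor
  · intro i
    refine ⟨B, fun v hv => ?_⟩
    have := h (Pi.single i v) fun j => by
      by_cases hj : j = i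
      · subst hj; simpa using hv
      · simpa [hj] using h0 j
    simpa using this
  · refine le_of_forall_pos_le_add fun ε hε => ?_
    have hc : 0 < (Fintype.card ι : ℝ) + 1 := by positivity
    have hlt : ∀ i, ∃ v ∈ S i, sSup (S i) - ε / (Fintype.card ι + 1) < v := fun i =>
      exists_lt_of_lt_csSup ⟨0, h0 i⟩ (by linarith [div_pos hε hc])
    choose v hv hlt using hlt
    have h1 := h v hv
    have h2 : ∑ i, (sSup (S i) - ε / (Fintype.card ι + 1)) ≤ ∑ i, v i :=
      Finset.sum_le_sum fun i _ => (hlt i).le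
    rw [Finset.sum_sub_distrib, Finset.sum_const, Finset.card_univ, nsmul_eq_mul] at h2
    have h3 : (Fintype.card ι : ℝ) * (ε / (Fintype.card ι + 1)) ≤ ε := by
      rw [mul_div_assoc', div_le_iff₀ hc]
      nlinarith
    linarith

/-- If the Jacobians and slopes of a finite family of shears add up to at most `C`, then so do the
variations of the compositions, relative to the variation of the original map. -/
lemma bddAbove_and_sum_Var_le {ι : Type*} [Fintype ι] (D : ι → ShearData) {f : Plane → Plane}
    (hf : ContinuousOn f (closure unitSq)) (hBV : IsBV f unitSq) {C : ℝ} (hC : 0 < C)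
    (hjac : ∀ x ∈ unitSq, ∑ i, (D i).jac (x 0) (x 1) ≤ C)
    (hslope : ∀ x ∈ unitSq, ∑ i, (1 + |(D i).slope (x 0) (x 1)|) ≤ C) :
    (∀ i, BddAbove (varSet (f ∘ (D i).inv) unitSq)) ∧
      ∑ i, Var (f ∘ (D i).inv) unitSq ≤ C * Var f unitSq := by
  refine bddAbove_and_sum_sSup_le (fun i => zero_mem_varSet _) fun v hv => ?_
  choose φ hφ hv using fun i => mem_varSet_iff.1 (hv i)
  have e : ∑ i, v i = pairing f (fun x => ∑ i, (D i).pull (φ i) x) := by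
    rw [pairing_sum _ hf fun i => (D i).contDiff_pull (hφ i).contDiff]
    exact Finset.sum_congr rfl fun i _ => by
      rw [hv, (D i).pairing_comp_inv f (hφ i).contDiff]
  rw [e]
  refine pairing_le_mul_Var hBV hC ?_
  set T : Set Plane := ⋃ i, tsupport ((D i).pull (φ i)) with hT
  have hTc : IsCompact T :=
    isCompact_iUnion fun i => (D i).hasCompactSupport_pull (hφ i).hasCompactSupport
  have hTQ : T ⊆ unitSq :=
    iUnion_subset fun i => (D i).tsupport_pull_subset_unitSq (hφ i).tsupport_subset
  have hz : ∀ x ∉ T, ∑ i, (D i).pull (φ i) x = 0 := fun x hx =>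
    Finset.sum_eq_zero fun i _ => image_eq_zero_of_notMem_tsupport fun h =>
      hx (mem_iUnion.2 ⟨i, h⟩)
  refine ⟨ContDiff.sum fun i _ => (D i).contDiff_pull (hφ i).contDiff,
    HasCompactSupport.intro hTc hz, ?_, fun x j => ?_⟩
  · refine (closure_minimal (fun x hx => ?_) hTc.isClosed).trans hTQ
    by_contra h
    exact hx (hz x h)
  · by_cases hx : x ∈ unitSq
    swap
    · rw [hz x fun h => hx (hTQ h)]
      simp [hC.le]
    have key : ∀ g : ι → Plane, (∀ i j, |g i j| ≤ 1) →
        |(∑ i, (D i).piola x (g i)) j| ≤ C := by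
      intro g hg
      have e : (∑ i, (D i).piola x (g i)) j = ∑ i, (D i).piola x (g i) j := by simp
      rw [e]
      fin_cases j
      · refine (Finset.abs_sum_le_sum_abs _ _).trans
          ((Finset.sum_le_sum fun i _ => ?_).trans (hjac x hx))
        simp only [ShearData.piola, Fin.zero_eta, PiLp.toLp_apply, Matrix.cons_val_zero, abs_mul,
          abs_of_pos ((D i).jac_pos _ _)]
        exact mul_le_of_le_one_right ((D i).jac_pos _ _).le (hg i 0)
      · refine (Finset.abs_sum_le_sum_abs _ _).trans
          ((Finset.sum_le_sum fun i _ => ?_).trans (hslope x hx))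
        simp only [ShearData.piola, Fin.mk_one, PiLp.toLp_apply, Matrix.cons_val_one,
          Matrix.cons_val_fin_one]
        refine (abs_sub _ _).trans (add_le_add (hg i 1) ?_)
        rw [abs_mul]
        exact mul_le_of_le_one_right (abs_nonneg _) (hg i 0)
    constructor
    · rw [Prod.fst_sum]
      exact key _ fun i j => ((hφ i).bound _ j).1
    · rw [Prod.snd_sum]
      exact key _ fun i j => ((hφ i).bound _ j).2

open Real (smoothTransition)

/-- A smooth step from `0` (left of `-1`) to `1` (right of `1`). -/
def stepFun (t : ℝ) : ℝ := ∫ u in t..t + 1, smoothTransition u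

/-- The derivative of `stepFun`. -/
def bump (t : ℝ) : ℝ := smoothTransition (t + 1) - smoothTransition t

lemma hasDerivAt_stepFun (t : ℝ) : HasDerivAt stepFun (bump t) t := by
  have hc := Real.smoothTransition.continuous
  have hd : ∀ t, HasDerivAt (fun t => ∫ u in (0 : ℝ)..t, smoothTransition u)
      (smoothTransition t) t := fun t =>
    intervalIntegral.integral_hasDerivAt_right (hc.intervalIntegrable _ _)
      hc.stronglyMeasurable.stronglyMeasurableAtFilter hc.continuousAt
  have e : stepFun = fun t => (∫ u in (0 : ℝ)..(t + 1), smoothTransition u) -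
      ∫ u in (0 : ℝ)..t, smoothTransition u := by
    ext t
    exact (intervalIntegral.integral_interval_sub_left (hc.intervalIntegrable _ _)
      (hc.intervalIntegrable _ _)).symm
  rw [e]
  exact ((hd (t + 1)).comp_add_const t 1).sub (hd t)

lemma bump_nonneg (t : ℝ) : 0 ≤ bump t :=
  sub_nonneg.2 (Real.smoothTransition.monotone (by linarith))

lemma bump_eq_zero {t : ℝ} (ht : 1 ≤ |t|) : bump t = 0 := by
  unfold bump
  rcases le_abs.1 ht with h | h
  · rw [Real.smoothTransition.one_of_one_le h, Real.smoothTransition.one_of_one_le (by linarith),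
      sub_self]
  · rw [Real.smoothTransition.zero_of_nonpos (by linarith),
      Real.smoothTransition.zero_of_nonpos (by linarith), sub_self]

lemma contDiff_bump : ContDiff ℝ 1 bump := by
  have h : ContDiff ℝ 1 smoothTransition := Real.smoothTransition.contDiff (n := 1)
  unfold bump
  fun_prop

lemma stepFun_mem (t : ℝ) : 0 ≤ stepFun t ∧ stepFun t ≤ 1 := by
  have hc := Real.smoothTransition.continuous
  constructor
  · exact intervalIntegral.integral_nonneg (by linarith) fun u _ => Real.smoothTransition.nonneg u
  · have := intervalIntegral.integral_mono_on (μ := volume) (a := t) (b := t + 1) (by linarith)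
      (hc.intervalIntegrable _ _) (continuous_const.intervalIntegrable _ _)
      (fun u _ => Real.smoothTransition.le_one u)
    simpa [stepFun] using this

lemma stepFun_eq_zero {t : ℝ} (ht : t ≤ -1) : stepFun t = 0 := by
  have : stepFun t = ∫ u in t..t + 1, (0 : ℝ) := by
    refine intervalIntegral.integral_congr fun u hu => ?_
    rw [uIcc_of_le (by linarith)] at hu
    exact Real.smoothTransition.zero_of_nonpos (by linarith [hu.2])
  simpa using this

lemma stepFun_eq_one {t : ℝ} (ht : 1 ≤ t) : stepFun t = 1 := by
  have : stepFun t = ∫ u in t..t + 1, (1 : ℝ) := by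
    refine intervalIntegral.integral_congr fun u hu => ?_
    rw [uIcc_of_le (by linarith)] at hu
    exact Real.smoothTransition.one_of_one_le (by linarith [hu.1])
  simpa using this

/-- The rescaled argument of the `i`-th step of the `s`-th staircase. -/
def stairArg (L N : ℕ) (s i : ℕ) (y : ℝ) : ℝ := (L + 1) * (N * y - i) - (s + 1)

/-- A smooth staircase with `N` steep steps, the position of the steps depending on `s`. -/
def stair (δ : ℝ) (L N s : ℕ) (y : ℝ) : ℝ :=
  δ * y + (1 - δ) / N * ∑ i ∈ Finset.range N, stepFun (stairArg L N s i y)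

/-- The derivative of `stair`. -/
def stairDeriv (δ : ℝ) (L N s : ℕ) (y : ℝ) : ℝ :=
  δ + (1 - δ) * ((L + 1) * ∑ i ∈ Finset.range N, bump (stairArg L N s i y))

lemma hasDerivAt_stair (δ : ℝ) {L N : ℕ} (hN : 0 < N) (s : ℕ) (y : ℝ) :
    HasDerivAt (stair δ L N s) (stairDeriv δ L N s y) y := by
  have hN' : (N : ℝ) ≠ 0 := by positivity
  have h1 : ∀ i ∈ Finset.range N, HasDerivAt (fun y => stepFun (stairArg L N s i y))
      (bump (stairArg L N s i y) * ((L + 1) * (N * 1))) y := fun i _ =>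
    (hasDerivAt_stepFun _).comp y
      (((((hasDerivAt_id y).const_mul (N : ℝ)).sub_const (i : ℝ)).const_mul (L + 1 : ℝ)).sub_const
        (s + 1 : ℝ))
  have h2 := ((hasDerivAt_id y).const_mul δ).add
    ((HasDerivAt.fun_sum h1).const_mul ((1 - δ) / N))
  refine h2.congr_deriv ?_
  rw [← Finset.sum_mul, stairDeriv]
  field_simp

lemma contDiff_stairDeriv (δ : ℝ) (L N s : ℕ) : ContDiff ℝ 1 (stairDeriv δ L N s) := by
  have h := contDiff_bump
  unfold stairDeriv stairArg
  fun_prop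

lemma le_stairDeriv {δ : ℝ} (h1 : δ ≤ 1) (L N s : ℕ) (y : ℝ) : δ ≤ stairDeriv δ L N s y := by
  have : 0 ≤ ∑ i ∈ Finset.range N, bump (stairArg L N s i y) :=
    Finset.sum_nonneg fun i _ => bump_nonneg _
  have h2 := sub_nonneg.2 h1
  unfold stairDeriv
  have : 0 ≤ (1 - δ) * ((L + 1) * ∑ i ∈ Finset.range N, bump (stairArg L N s i y)) := by positivity
  linarith

lemma abs_sum_sub_le {N : ℕ} {a : ℕ → ℝ} {t : ℝ} (h0 : 0 ≤ t) (hN : t ≤ N)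
    (ha : ∀ i, 0 ≤ a i ∧ a i ≤ 1) (h1 : ∀ i : ℕ, (i : ℝ) + 1 ≤ t → a i = 1)
    (h2 : ∀ i : ℕ, t ≤ i → a i = 0) : |∑ i ∈ Finset.range N, a i - t| ≤ 1 := by
  induction N with
  | zero =>
    have : t = 0 := le_antisymm (by simpa using hN) h0
    simp [this]
  | succ N ih =>
    rw [Finset.sum_range_succ]
    by_cases ht : t ≤ N
    · rw [h2 N ht, add_zero]
      exact ih ht
    · push Not at ht
      have : ∑ i ∈ Finset.range N, a i = N := by
        rw [Finset.sum_congr rfl (g := fun _ => (1 : ℝ))]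
        · simp
        · intro i hi
          have : (i : ℝ) + 1 ≤ N := by exact_mod_cast Finset.mem_range.1 hi
          exact h1 i (by linarith)
      push_cast at hN
      rw [this, abs_le]
      constructor <;> linarith [(ha N).1, (ha N).2]

lemma stepFun_stairArg_eq_one {L N s i : ℕ} (hs : s < L) {y : ℝ} (h : (i : ℝ) + 1 ≤ N * y) :
    stepFun (stairArg L N s i y) = 1 := by
  have hs' : (s : ℝ) + 1 ≤ L := by exact_mod_cast hs
  refine stepFun_eq_one ?_
  unfold stairArg
  nlinarith

lemma stepFun_stairArg_eq_zero {L N s i : ℕ} {y : ℝ} (h : N * y ≤ (i : ℝ)) :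
    stepFun (stairArg L N s i y) = 0 := by
  have hs' : (0 : ℝ) ≤ s := by positivity
  have hL' : (0 : ℝ) ≤ L := by positivity
  refine stepFun_eq_zero ?_
  unfold stairArg
  nlinarith

lemma abs_stair_sub_le {δ : ℝ} (h0 : 0 < δ) (h1 : δ ≤ 1) {L N s : ℕ} (hN : 0 < N) (hs : s < L)
    {y : ℝ} (hy0 : 0 ≤ y) (hy1 : y ≤ 1) : |stair δ L N s y - y| ≤ 1 / N := by
  have hN' : (0 : ℝ) < N := by positivity
  have h := abs_sum_sub_le (N := N) (t := N * y) (by positivity)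
    (mul_le_of_le_one_right hN'.le hy1) (fun i => stepFun_mem (stairArg L N s i y))
    (fun i => stepFun_stairArg_eq_one hs) (fun i => stepFun_stairArg_eq_zero)
  have e : stair δ L N s y - y = (1 - δ) / N *
      (∑ i ∈ Finset.range N, stepFun (stairArg L N s i y) - N * y) := by
    unfold stair
    field_simp
    ring
  rw [e, abs_mul, abs_of_nonneg (div_nonneg (sub_nonneg.2 h1) hN'.le)]
  calc _ ≤ (1 - δ) / N * 1 := mul_le_mul_of_nonneg_left h (div_nonneg (sub_nonneg.2 h1) hN'.le)
    _ ≤ 1 / N := by rw [mul_one]; gcongr; linarith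

lemma stair_zero (δ : ℝ) (L N s : ℕ) : stair δ L N s 0 = 0 := by
  unfold stair
  rw [Finset.sum_eq_zero fun i _ => stepFun_stairArg_eq_zero (by simp)]
  simp

lemma stair_one (δ : ℝ) {L N s : ℕ} (hN : 0 < N) (hs : s < L) : stair δ L N s 1 = 1 := by
  have hN' : (N : ℝ) ≠ 0 := by positivity
  unfold stair
  rw [Finset.sum_congr rfl (g := fun _ => (1 : ℝ))]
  · simp
    field_simp
    ring
  · intro i hi
    refine stepFun_stairArg_eq_one hs ?_
    rw [mul_one]
    exact_mod_cast Finset.mem_range.1 hi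

lemma sum_bump_le_one (L N : ℕ) (y : ℝ) :
    ∑ s ∈ Finset.range L, ∑ i ∈ Finset.range N, bump (stairArg L N s i y) ≤ 1 := by
  rw [Finset.sum_comm]
  let c : ℕ → ℝ := fun i => smoothTransition ((L + 1) * (N * y - i) + 1)
  have h : ∀ i ∈ Finset.range N, ∑ s ∈ Finset.range L, bump (stairArg L N s i y)
      ≤ c i - c (i + 1) := by
    intro i _
    let d : ℕ → ℝ := fun s => smoothTransition ((L + 1) * (N * y - i) - s + 1)
    have h1 : ∀ s ∈ Finset.range L, bump (stairArg L N s i y) = d (s + 1) - d (s + 2) := by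
      intro s _
      simp only [d, bump, stairArg]
      push_cast
      congr 2; ring_nf
    have h2 : ∑ s ∈ Finset.range L, (d (s + 1) - d (s + 2)) = d 1 - d (L + 1) :=
      Finset.sum_range_sub' (fun s => d (s + 1)) L
    rw [Finset.sum_congr rfl h1, h2]
    have h3 : d 1 ≤ c i := Real.smoothTransition.monotone (by push_cast; linarith)
    have h4 : d (L + 1) = c (i + 1) := by
      simp only [d, c]
      push_cast
      congr 1
      ring
    linarith
  refine (Finset.sum_le_sum h).trans ?_
  rw [Finset.sum_range_sub']
  have h1 := Real.smoothTransition.le_one ((L + 1) * (N * y - (0 : ℕ)) + 1)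
  have h2 := Real.smoothTransition.nonneg ((L + 1) * (N * y - N) + 1)
  simp only [c]
  linarith

/-- The places where the `s`-th staircase is steep. -/
def steepSet (L N s : ℕ) : Set ℝ := {y | ∃ i < N, |stairArg L N s i y| < 1}

lemma isOpen_steepSet (L N s : ℕ) : IsOpen (steepSet L N s) := by
  have : steepSet L N s = ⋃ i, ⋃ _ : i < N, {y | |stairArg L N s i y| < 1} := by
    ext y; simp [steepSet]
  rw [this]
  refine isOpen_iUnion fun i => isOpen_iUnion fun _ => isOpen_lt ?_ continuous_const
  unfold stairArg
  fun_prop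

lemma stairDeriv_eq {δ : ℝ} {L N s : ℕ} {y : ℝ} (h : y ∉ steepSet L N s) :
    stairDeriv δ L N s y = δ := by
  unfold stairDeriv
  rw [Finset.sum_eq_zero fun i hi => bump_eq_zero ?_]
  · simp
  · by_contra h'
    exact h ⟨i, Finset.mem_range.1 hi, not_le.1 h'⟩

open Classical in
lemma card_steepSet_le (L N : ℕ) (y : ℝ) :
    (Finset.univ.filter fun s : Fin L => y ∈ steepSet L N s).card ≤ 2 := by
  set m := ⌊((L : ℝ) + 1) * (N * y)⌋ with hm
  have hinj : Function.Injective fun s : Fin L => ((s : ℕ) : ℤ) + 1 := by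
    intro a b hab
    simp only at hab
    ext
    omega
  rw [← Finset.card_image_of_injective _ hinj]
  refine (Finset.card_le_card (t := {m % (L + 1), (m + 1) % (L + 1)}) ?_).trans
    Finset.card_le_two
  intro z hz
  obtain ⟨s, hs, rfl⟩ := Finset.mem_image.1 hz
  obtain ⟨i, -, hi⟩ := (Finset.mem_filter.1 hs).2
  unfold stairArg at hi
  obtain ⟨h1, h2⟩ := abs_lt.1 hi
  have hf := Int.floor_le (((L : ℝ) + 1) * (N * y))
  have hf' := Int.lt_floor_add_one (((L : ℝ) + 1) * (N * y))
  rw [← hm] at hf hf'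
  set j : ℤ := ((s : ℕ) + 1) + (L + 1) * i with hj
  have hjr : (j : ℝ) = (s : ℕ) + 1 + (L + 1) * i := by rw [hj]; push_cast; ring
  have u1 : j < m + 2 := by
    have : (j : ℝ) < ((m + 2 : ℤ) : ℝ) := by push_cast; linarith
    exact_mod_cast this
  have u2 : m - 1 < j := by
    have : ((m - 1 : ℤ) : ℝ) < j := by push_cast; linarith
    exact_mod_cast this
  have hmod : j % (L + 1) = (s : ℕ) + 1 := by
    rw [hj, Int.add_mul_emod_self_left]
    exact Int.emod_eq_of_lt (by positivity) (by have := s.2; omega)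
  simp only [Finset.mem_insert, Finset.mem_singleton]
  rw [← hmod]
  have : j = m ∨ j = m + 1 := by omega
  rcases this with h | h <;> simp [h]

/-- A smooth cut-off, equal to one on `[ρ, 1 - ρ]` and vanishing outside of `(0, 1)`. -/
def cutoff (ρ x : ℝ) : ℝ := smoothTransition (x / ρ) * smoothTransition ((1 - x) / ρ)

lemma contDiff_cutoff (ρ : ℝ) : ContDiff ℝ 2 (cutoff ρ) := by
  have h : ContDiff ℝ 2 smoothTransition := Real.smoothTransition.contDiff (n := 2)
  unfold cutoff
  fun_prop

lemma contDiff_deriv_cutoff (ρ : ℝ) : ContDiff ℝ 1 (deriv (cutoff ρ)) := by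
  have h := contDiff_cutoff ρ
  rw [show (2 : WithTop ℕ∞) = 1 + 1 by norm_num, contDiff_succ_iff_deriv] at h
  exact h.2.2

/-- The shear with profile `stair` and cut-off `cutoff`. -/
def stairShear {ρ δ : ℝ} (hρ : 0 < ρ) (h0 : 0 < δ) (h1 : δ ≤ 1) {L N : ℕ} (hN : 0 < N)
    (s : Fin L) : ShearData where
  χ := cutoff ρ
  dχ := deriv (cutoff ρ)
  k := stair δ L N s
  w := stairDeriv δ L N s
  δ := δ
  hasDerivAt_χ x := ((contDiff_cutoff ρ).differentiable two_ne_zero x).hasDerivAt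
  contDiff_dχ := contDiff_deriv_cutoff ρ
  hasDerivAt_k := hasDerivAt_stair δ hN s
  contDiff_w := contDiff_stairDeriv δ L N s
  χ_nonneg x := mul_nonneg (Real.smoothTransition.nonneg _) (Real.smoothTransition.nonneg _)
  χ_le_one x := mul_le_one₀ (Real.smoothTransition.le_one _) (Real.smoothTransition.nonneg _)
    (Real.smoothTransition.le_one _)
  χ_left x hx := by
    rw [cutoff, Real.smoothTransition.zero_of_nonpos (div_nonpos_of_nonpos_of_nonneg hx hρ.le),
      zero_mul]
  χ_right x hx := by
    rw [cutoff, Real.smoothTransition.zero_of_nonpos (x := (1 - x) / ρ)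
      (div_nonpos_of_nonpos_of_nonneg (by linarith) hρ.le), mul_zero]
  δ_pos := h0
  δ_le_one := h1
  δ_le_w := le_stairDeriv h1 L N s
  k_zero := stair_zero δ L N s
  k_one := stair_one δ hN s.2

lemma cutoff_eq_one {ρ x : ℝ} (hρ : 0 < ρ) (h1 : ρ ≤ x) (h2 : x ≤ 1 - ρ) : cutoff ρ x = 1 := by
  rw [cutoff, Real.smoothTransition.one_of_one_le ((one_le_div hρ).2 h1),
    Real.smoothTransition.one_of_one_le ((one_le_div hρ).2 (by linarith)), mul_one]

open Classical in
lemma exists_shear_family {ρ δ η : ℝ} (hρ : 0 < ρ) (h0 : 0 < δ) (h1 : δ ≤ 1) (hη : 0 < η)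
    {L : ℕ} (hL : 0 < L) :
    ∃ (D : Fin L → ShearData) (B : Fin L → Set ℝ),
      (∀ s y, 0 ≤ y → y ≤ 1 → |(D s).k y - y| ≤ η) ∧
      (∀ x ∈ unitSq, ∑ s, (D s).jac (x 0) (x 1) ≤ L + 1) ∧
      (∀ x ∈ unitSq, ∑ s, (1 + |(D s).slope (x 0) (x 1)|) ≤ L + 1) ∧
      (∀ s x y, ρ ≤ x → x ≤ 1 - ρ → y ∉ B s → (D s).jac x y = δ) ∧
      (∀ s, IsOpen (B s)) ∧
      (∀ y, (Finset.univ.filter fun s => y ∈ B s).card ≤ 2) := by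
  obtain ⟨C, hC⟩ := (isCompact_Icc (a := (0 : ℝ)) (b := 1)).exists_bound_of_continuousOn
    (contDiff_deriv_cutoff ρ).continuous.continuousOn
  have hL' : (0 : ℝ) < L := by positivity
  obtain ⟨N, hN⟩ := exists_nat_gt (max (1 / η) (L * |C|))
  have hNη := (le_max_left _ _).trans_lt hN
  have hNC := (le_max_right _ _).trans_lt hN
  have hN' : (0 : ℝ) < N := (one_div_pos.2 hη).trans hNη
  have hN0 : 0 < N := by exact_mod_cast hN'
  refine ⟨stairShear hρ h0 h1 hN0, fun s => steepSet L N s, fun s y a b => ?_, fun x hx => ?_,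
    fun x hx => ?_, fun s x y a b c => ?_, fun s => isOpen_steepSet L N s, card_steepSet_le L N⟩
  · refine (abs_stair_sub_le h0 h1 hN0 s.2 a b).trans ?_
    rw [div_le_iff₀ hN']
    rw [div_lt_iff₀ hη] at hNη
    linarith
  · have h := sum_bump_le_one L N (x 1)
    rw [Finset.sum_range (fun s => ∑ i ∈ Finset.range N, bump (stairArg L N s i (x 1)))] at h
    have e : ∀ s : Fin L, (stairShear hρ h0 h1 hN0 s).jac (x 0) (x 1) =
        1 - cutoff ρ (x 0) * (1 - δ) + cutoff ρ (x 0) * (1 - δ) * ((L + 1) *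
          ∑ i ∈ Finset.range N, bump (stairArg L N s i (x 1))) := by
      intro s
      simp only [ShearData.jac, stairShear, stairDeriv]
      ring
    rw [Finset.sum_congr rfl fun s _ => e s, Finset.sum_add_distrib, ← Finset.mul_sum,
      ← Finset.mul_sum]
    simp only [Finset.sum_const, Finset.card_univ, Fintype.card_fin, nsmul_eq_mul]
    set a := cutoff ρ (x 0) * (1 - δ)
    have hc0 : 0 ≤ cutoff ρ (x 0) := (stairShear hρ h0 h1 hN0 ⟨0, hL⟩).χ_nonneg (x 0)
    have hc1 : cutoff ρ (x 0) ≤ 1 := (stairShear hρ h0 h1 hN0 ⟨0, hL⟩).χ_le_one (x 0)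
    have ha0 : 0 ≤ a := mul_nonneg hc0 (by linarith)
    have ha1 : a ≤ 1 := mul_le_one₀ hc1 (by linarith) (by linarith)
    have : a * ((L + 1) * ∑ s : Fin L, ∑ i ∈ Finset.range N, bump (stairArg L N s i (x 1)))
        ≤ a * ((L + 1) * 1) := by gcongr
    nlinarith
  · have : ∀ s : Fin L, 1 + |(stairShear hρ h0 h1 hN0 s).slope (x 0) (x 1)| ≤ 1 + 1 / L := by
      intro s
      have hk := abs_stair_sub_le h0 h1 hN0 s.2 hx.2.2.1.le hx.2.2.2.le
      have hc := hC (x 0) ⟨hx.1.le, hx.2.1.le⟩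
      rw [Real.norm_eq_abs] at hc
      simp only [ShearData.slope, stairShear, abs_mul]
      gcongr
      calc _ ≤ |C| * (1 / N) :=
            mul_le_mul (hc.trans (le_abs_self C)) hk (abs_nonneg _) (abs_nonneg _)
        _ ≤ 1 / L := by
          rw [mul_one_div, div_le_div_iff₀ hN' hL']
          linarith
    refine (Finset.sum_le_sum fun s _ => this s).trans ?_
    simp only [Finset.sum_const, Finset.card_univ, Fintype.card_fin, nsmul_eq_mul]
    field_simp
    rfl
  · simp only [ShearData.jac, stairShear, stairDeriv_eq c, cutoff_eq_one hρ a b]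
    ring

lemma dist_le_supDist {f g : Plane → Plane} (hf : MapsTo f unitSq unitSq)
    (hg : MapsTo g unitSq unitSq) {x : Plane} (hx : x ∈ unitSq) :
    dist (f x) (g x) ≤ supDist f g unitSq := by
  have hb : Bornology.IsBounded unitSq :=
    isCompact_closure_unitSq.isBounded.subset subset_closure
  obtain ⟨C, hC⟩ := Metric.isBounded_iff.1 hb
  refine le_ciSup (f := fun x : unitSq => dist (f x) (g x)) ⟨C, ?_⟩ ⟨x, hx⟩
  rintro _ ⟨y, rfl⟩
  exact hC (hf y.2) (hg y.2)

lemma supDist_le {f g : Plane → Plane} {r : ℝ} (hr : 0 ≤ r)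
    (h : ∀ x ∈ unitSq, dist (f x) (g x) ≤ r) : supDist f g unitSq ≤ r :=
  Real.iSup_le (fun x => h x x.2) hr

lemma supDist_nonneg (f g : Plane → Plane) : 0 ≤ supDist f g unitSq :=
  Real.iSup_nonneg fun _ => dist_nonneg

lemma IsHomeoOn.mapsTo_inv {f g : Plane → Plane} (h : IsHomeoOn f g unitSq unitSq) :
    MapsTo g unitSq unitSq := h.2.2.1.1.mapsTo h.1.surjOn

lemma IsHomeoOn.image_eq {f g : Plane → Plane} (h : IsHomeoOn f g unitSq unitSq) {E : Set Plane}
    (hE : E ⊆ unitSq) : f '' E = unitSq ∩ g ⁻¹' E := by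
  ext z
  constructor
  · rintro ⟨x, hx, rfl⟩
    refine ⟨h.1.mapsTo (hE hx), ?_⟩
    rwa [mem_preimage, h.2.2.1.1 (hE hx)]
  · rintro ⟨hz, hgz⟩
    exact ⟨g z, hgz, h.2.2.1.2 hz⟩

/-- The homeomorphisms in `X M` mapping some open set of measure less than `ε` onto a set of measure
larger than `1 - ε`. -/
def almostFull (M ε : ℝ) : Set ((Plane → Plane) × (Plane → Plane)) :=
  {p ∈ X M | ∃ E, IsOpen E ∧ E ⊆ unitSq ∧ volume E < ENNReal.ofReal ε ∧
    ENNReal.ofReal (1 - ε) < volume (p.1 '' E)}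

lemma openInX_almostFull (M ε : ℝ) : OpenInX M (almostFull M ε) := by
  refine ⟨fun p hp => hp.1, ?_⟩
  rintro ⟨f, g⟩ ⟨hp, E, hEo, hEQ, hE, hfE⟩
  simp only at hfE
  have hh : IsHomeoOn f g unitSq unitSq := hp.1
  have ho : IsOpen (f '' E) := by
    rw [hh.image_eq hEQ]
    exact hh.2.2.2.isOpen_inter_preimage isOpen_unitSq hEo
  obtain ⟨K, hKE, hK, hKv⟩ := ho.exists_lt_isCompact hfE
  have hKQ : K ⊆ unitSq := by
    rw [hh.image_eq hEQ] at hKE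
    exact hKE.trans inter_subset_left
  have hgK : g '' K ⊆ E := by
    rw [hh.image_eq hEQ] at hKE
    exact image_subset_iff.2 (hKE.trans inter_subset_right)
  obtain ⟨r, hr, hrE⟩ := (hK.image_of_continuousOn (hh.2.2.2.mono hKQ)).exists_thickening_subset_open
    hEo hgK
  refine ⟨r, hr, ?_⟩
  rintro ⟨f', g'⟩ hq hd
  have hh' : IsHomeoOn f' g' unitSq unitSq := hq.1
  refine ⟨hq, E, hEo, hEQ, hE, hKv.trans_le (measure_mono ?_)⟩
  simp only
  rw [hh'.image_eq hEQ]
  intro z hz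
  refine ⟨hKQ hz, hrE (Metric.mem_thickening_iff.2 ⟨g z, mem_image_of_mem g hz, ?_⟩)⟩
  have h1 := dist_le_supDist hh.mapsTo_inv hh'.mapsTo_inv (hKQ hz)
  have h2 := supDist_nonneg f f'
  rw [dist_comm]
  simp only [dX] at hd
  linarith [abs_nonneg (1 / (M - Var f unitSq) - 1 / (M - Var f' unitSq))]

lemma iInter_almostFull_subset (M : ℝ) : ⋂ n : ℕ, almostFull M ((1 / 2) ^ n) ⊆ Afull M := by
  rintro ⟨f, g⟩ hp
  rw [mem_iInter] at hp
  have hX := (hp 0).1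
  have hh : IsHomeoOn f g unitSq unitSq := hX.1
  choose _ E hEo hEQ hE hfE using hp
  have hsum : ∑' n : ℕ, ENNReal.ofReal ((1 / 2 : ℝ) ^ n) ≠ ∞ :=
    (summable_geometric_two).tsum_ofReal_ne_top
  have hmeas : ∀ n, MeasurableSet (f '' E n) := fun n => by
    rw [hh.image_eq (hEQ n)]
    exact (hh.2.2.2.isOpen_inter_preimage isOpen_unitSq (hEo n)).measurableSet
  have hfQ : ∀ n, f '' E n ⊆ unitSq := fun n =>
    (image_mono (hEQ n)).trans hh.1.mapsTo.image_subset
  have h0 : volume (Filter.limsup E Filter.atTop) = 0 :=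
    measure_limsup_atTop_eq_zero (ne_top_of_le_ne_top hsum (ENNReal.tsum_le_tsum fun n => (hE n).le))
  have h1 : volume (Filter.limsup (fun n => unitSq \ f '' E n) Filter.atTop) = 0 := by
    refine measure_limsup_atTop_eq_zero (ne_top_of_le_ne_top hsum (ENNReal.tsum_le_tsum fun n => ?_))
    rw [measure_sdiff (hfQ n) (hmeas n).nullMeasurableSet
      (measure_ne_top_of_subset (hfQ n) (by simp [volume_unitSq])), volume_unitSq]
    refine tsub_le_iff_left.2 ?_
    refine le_trans ?_ (add_le_add_left (hfE n).le _)
    rw [← ENNReal.ofReal_add (sub_nonneg.2 (pow_le_one₀ (by norm_num) (by norm_num)))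
      (by positivity)]
    simp
  have hsub : Filter.limsup E Filter.atTop ⊆ unitSq := by
    rw [Filter.limsup_eq_iInf_iSup_of_nat]
    exact (iInf_le _ 0).trans (iSup_le fun n => iSup_le fun _ => hEQ n)
  refine ⟨hX, _, hsub, h0, le_antisymm ?_ ?_⟩
  · rw [← volume_unitSq]
    exact measure_mono ((image_mono hsub).trans hh.1.mapsTo.image_subset)
  · rw [← volume_unitSq, ← add_zero (volume (f '' _)), ← h1]
    refine (measure_mono fun z hz => ?_).trans (measure_union_le _ _)
    by_cases hz' : z ∈ Filter.limsup (fun n => unitSq \ f '' E n) Filter.atTop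
    · exact Or.inr hz'
    refine Or.inl ⟨g z, ?_, hh.2.2.1.2 hz⟩
    rw [Filter.mem_limsup_iff_frequently_mem, Filter.not_frequently] at hz'
    rw [Filter.mem_limsup_iff_frequently_mem]
    refine (hz'.mono fun n hn => ?_).frequently
    have : z ∈ f '' E n := by_contra fun h => hn ⟨hz, h⟩
    rw [hh.image_eq (hEQ n)] at this
    exact this.2

lemma exists_volume_strip_lt {g : Plane → Plane} (hg : MapsTo g unitSq unitSq)
    (hgc : ContinuousOn g unitSq) {θ : ℝ} (hθ : 0 < θ) :
    ∃ ρ > 0, volume (unitSq ∩ g ⁻¹' {x | ρ ≤ x 0 ∧ x 0 ≤ 1 - ρ}ᶜ) < ENNReal.ofReal θ := by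
  set S : ℕ → Set Plane := fun n =>
    unitSq ∩ g ⁻¹' {x | 1 / ((n : ℝ) + 1) ≤ x 0 ∧ x 0 ≤ 1 - 1 / ((n : ℝ) + 1)}ᶜ with hS
  have hm : ∀ n, MeasurableSet (S n) := fun n => by
    refine (hgc.isOpen_inter_preimage isOpen_unitSq ?_).measurableSet
    rw [isOpen_compl_iff]
    have h0 : Continuous fun p : Plane => p 0 := by fun_prop
    exact (isClosed_le continuous_const h0).and (isClosed_le h0 continuous_const)
  have ha : Antitone S := fun m n hmn => by
    refine inter_subset_inter_right _ (preimage_mono (compl_subset_compl.2 fun x hx => ?_))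
    have : 1 / ((n : ℝ) + 1) ≤ 1 / ((m : ℝ) + 1) := Nat.one_div_le_one_div hmn
    exact ⟨this.trans hx.1, by linarith [hx.2]⟩
  have he : ⋂ n, S n = ∅ := by
    refine eq_empty_of_forall_notMem fun z hz => ?_
    rw [mem_iInter] at hz
    have hzQ := hg (hz 0).1
    obtain ⟨n, hn⟩ := exists_nat_one_div_lt (lt_min hzQ.1 (sub_pos.2 hzQ.2.1))
    exact (hz n).2 ⟨(lt_min_iff.1 hn).1.le, by linarith [(lt_min_iff.1 hn).2]⟩
  have ht := tendsto_measure_iInter_atTop (μ := volume) (fun n => (hm n).nullMeasurableSet) ha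
    ⟨0, measure_ne_top_of_subset inter_subset_left (by simp [volume_unitSq])⟩
  rw [he, measure_empty] at ht
  obtain ⟨n, hn⟩ := (ht.eventually_lt_const (ENNReal.ofReal_pos.2 hθ)).exists
  exact ⟨_, Nat.one_div_pos_of_nat, hn⟩

lemma ShearData.volume_image_map_le (D : ShearData) {δ : ℝ} (hδ : 0 ≤ δ) {F : Set Plane}
    (hF : MeasurableSet F) (hj : ∀ x ∈ F, D.jac (x 0) (x 1) = δ) :
    volume (D.map '' F) ≤ ENNReal.ofReal δ * volume F := by
  refine (addHaar_image_le_lintegral_abs_det_fderiv volume hF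
    fun x _ => (D.hasFDerivAt_map x).hasFDerivWithinAt).trans_eq ?_
  rw [setLIntegral_congr_fun (g := fun _ => ENNReal.ofReal δ) hF, setLIntegral_const]
  intro x hx
  simp only
  rw [D.det_deriv, hj x hx, abs_of_nonneg hδ]

open Classical in
lemma sum_measureReal_le_of_card_le {ι : Type*} [Fintype ι] {A : ι → Set Plane}
    (hA : ∀ i, MeasurableSet (A i)) (hAQ : ∀ i, A i ⊆ unitSq) {n : ℕ}
    (hn : ∀ z, (Finset.univ.filter fun i => z ∈ A i).card ≤ n) :
    ∑ i, volume.real (A i) ≤ n := by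
  have h : ∑ i, volume (A i) ≤ n := by
    calc ∑ i, volume (A i) = ∑ i, ∫⁻ z in unitSq, (A i).indicator 1 z := by
          refine Finset.sum_congr rfl fun i _ => ?_
          rw [lintegral_indicator_one (hA i), Measure.restrict_apply (hA i),
            inter_eq_left.2 (hAQ i)]
      _ = ∫⁻ z in unitSq, ∑ i, (A i).indicator 1 z :=
          (lintegral_finsetSum _ fun i _ => measurable_one.indicator (hA i)).symm
      _ ≤ ∫⁻ z in unitSq, n := by
          refine lintegral_mono fun z => ?_
          simp only [indicator_apply, Pi.one_apply, Finset.sum_boole]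
          exact_mod_cast hn z
      _ = n := by simp [volume_unitSq]
  have hfin : ∀ i, volume (A i) ≠ ∞ := fun i =>
    measure_ne_top_of_subset (hAQ i) (by simp [volume_unitSq])
  simp only [measureReal_def]
  rw [← ENNReal.toReal_sum fun i _ => hfin i]
  simpa using ENNReal.toReal_mono (by simp) h

lemma exists_index_lt {V τ θ : ℝ} (hV : 0 ≤ V) (hτ : 0 < τ) (hθ : 0 < θ) (C : ℝ) :
    ∃ L : ℕ, 0 < L ∧ ∀ v a : Fin L → ℝ, (∀ s, 0 ≤ v s) → (∀ s, 0 ≤ a s) →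
      ∑ s, v s ≤ (L + 1) * V → ∑ s, a s ≤ C → ∃ s, v s < V + τ ∧ a s < θ := by
  set c := (V + 1) / θ with hc
  have hc0 : 0 < c := by positivity
  obtain ⟨L, hL⟩ := exists_nat_gt (max 0 ((V + c * C) / min τ 1))
  have hL0 : (0 : ℝ) < L := (le_max_left _ _).trans_lt hL
  have hL1 := (le_max_right _ _).trans_lt hL
  rw [div_lt_iff₀ (by positivity)] at hL1
  refine ⟨L, by exact_mod_cast hL0, fun v a hv ha hvs has => ?_⟩
  have h : ∑ s, (v s + c * a s) < ∑ s : Fin L, (V + min τ 1) := by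
    rw [Finset.sum_add_distrib, ← Finset.mul_sum]
    simp only [Finset.sum_const, Finset.card_univ, Fintype.card_fin, nsmul_eq_mul]
    have := mul_le_mul_of_nonneg_left has hc0.le
    nlinarith
  obtain ⟨s, -, hs⟩ := Finset.exists_lt_of_sum_lt h
  refine ⟨s, ?_, ?_⟩
  · have := mul_nonneg hc0.le (ha s)
    linarith [min_le_left τ 1]
  · have : c * a s < c * θ := by
      rw [hc, div_mul_cancel₀ _ hθ.ne', ← hc]
      linarith [min_le_right τ 1, hv s]
    exact lt_of_mul_lt_mul_left this hc0.le

/-- A homeomorphism can be composed with a shear contracting most of the image, with a small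
increase of the variation. -/
lemma exists_shear {f g : Plane → Plane} (hh : IsHomeoOn f g unitSq unitSq)
    (hf : ContinuousOn f (closure unitSq)) (hBV : IsBV f unitSq) {η τ θ δ : ℝ} (hη : 0 < η)
    (hτ : 0 < τ) (hθ : 0 < θ) (h0 : 0 < δ) (h1 : δ ≤ 1) :
    ∃ D : ShearData, (∀ y, 0 ≤ y → y ≤ 1 → |D.k y - y| ≤ η) ∧
      BddAbove (varSet (f ∘ D.inv) unitSq) ∧ Var (f ∘ D.inv) unitSq < Var f unitSq + τ ∧
      ∃ F ⊆ unitSq, MeasurableSet F ∧ (∀ x ∈ F, D.jac (x 0) (x 1) = δ) ∧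
        volume (unitSq \ f '' F) < ENNReal.ofReal (θ + θ) := by
  classical
  obtain ⟨ρ, hρ, hstrip⟩ := exists_volume_strip_lt hh.mapsTo_inv hh.2.2.2 hθ
  obtain ⟨L, hL, hsel⟩ := exists_index_lt (Var_nonneg hBV.2) hτ hθ (2 : ℕ)
  obtain ⟨D, B, hk, hjac, hslope, hδ, hB, hcard⟩ := exists_shear_family hρ h0 h1 hη hL
  obtain ⟨hbdd, hsum⟩ := bddAbove_and_sum_Var_le D hf hBV (by positivity) hjac hslope
  have hc1 : Continuous fun p : Plane => p 1 := by fun_prop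
  have hc0 : Continuous fun p : Plane => p 0 := by fun_prop
  set A : Fin L → Set Plane := fun s => unitSq ∩ g ⁻¹' {x | x 1 ∈ B s}
  have hAm : ∀ s, MeasurableSet (A s) := fun s =>
    (hh.2.2.2.isOpen_inter_preimage isOpen_unitSq ((hB s).preimage hc1)).measurableSet
  obtain ⟨s, hs1, hs2⟩ := hsel (fun s => Var (f ∘ (D s).inv) unitSq)
    (fun s => volume.real (A s)) (fun s => Var_nonneg (hbdd s)) (fun s => measureReal_nonneg) hsum
    (sum_measureReal_le_of_card_le hAm (fun s => inter_subset_left) fun z =>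
      (Finset.card_le_card fun s hs => by
        simp only [Finset.mem_filter, Finset.mem_univ, true_and] at hs ⊢
        exact hs.2).trans (hcard (g z 1)))
  set G : Set Plane := {x | ρ ≤ x 0 ∧ x 0 ≤ 1 - ρ}
  have hGm : MeasurableSet G :=
    ((isClosed_le continuous_const hc0).and (isClosed_le hc0 continuous_const)).measurableSet
  have hF : unitSq ∩ (G ∩ {x | x 1 ∈ B s}ᶜ) ⊆ unitSq := inter_subset_left
  refine ⟨D s, hk s, hbdd s, hs1, unitSq ∩ (G ∩ {x | x 1 ∈ B s}ᶜ), hF,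
    measurableSet_unitSq.inter (hGm.inter ((hB s).preimage hc1).measurableSet.compl),
    fun x hx => hδ s _ _ hx.2.1.1 hx.2.1.2 hx.2.2, ?_⟩
  have hsub : unitSq \ f '' (unitSq ∩ (G ∩ {x | x 1 ∈ B s}ᶜ)) ⊆ unitSq ∩ g ⁻¹' Gᶜ ∪ A s := by
    rw [hh.image_eq hF]
    rintro z ⟨hz, hz'⟩
    by_cases hzG : g z ∈ G
    · refine Or.inr ⟨hz, by_contra fun h => hz' ⟨hz, hh.mapsTo_inv hz, hzG, h⟩⟩
    · exact Or.inl ⟨hz, hzG⟩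
  have hA : volume (A s) < ENNReal.ofReal θ :=
    (ENNReal.lt_ofReal_iff_toReal_lt
      (measure_ne_top_of_subset inter_subset_left (by simp [volume_unitSq]))).2 hs2
  calc _ ≤ _ := measure_mono hsub
    _ ≤ _ := measure_union_le _ _
    _ < _ := ENNReal.add_lt_add hstrip hA
    _ = _ := (ENNReal.ofReal_add hθ.le hθ.le).symm

lemma mem_X_comp_shear {M : ℝ} {f g : Plane → Plane} (hp : (f, g) ∈ X M) (D : ShearData)
    (hb : BddAbove (varSet (f ∘ D.inv) unitSq)) (hV : Var (f ∘ D.inv) unitSq < M) :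
    (f ∘ D.inv, D.map ∘ g) ∈ X M := by
  obtain ⟨⟨hbij, hfc, hinv, hgc⟩, ⟨hfcl, hfr⟩, -, -⟩ := hp
  simp only at hbij hfc hinv hgc hfcl hfr
  have hD : BijOn D.inv unitSq unitSq :=
    ⟨fun x hx => D.inv_mem_unitSq.2 hx, (Function.LeftInverse.injective D.map_inv).injOn,
      fun x hx => ⟨D.map x, D.map_mem_unitSq.2 hx, D.inv_map x⟩⟩
  have hcont : ContinuousOn (f ∘ D.inv) (closure unitSq) :=
    hfcl.comp D.continuous_inv.continuousOn D.mapsTo_inv_closure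
  refine ⟨⟨hbij.comp hD, hcont.mono subset_closure, ⟨fun x hx => ?_, fun x hx => ?_⟩,
    D.continuous_map.comp_continuousOn hgc⟩, ⟨hcont, fun x hx => ?_⟩, ⟨?_, hb⟩, hV⟩
  · simp only [Function.comp_apply]
    rw [hinv.1 (hD.mapsTo hx), D.map_inv]
  · simp only [Function.comp_apply]
    rw [D.inv_map, hinv.2 hx]
  · simp only [Function.comp_apply]
    rw [D.inv_of_mem_frontier hx, hfr hx]
  · exact (hcont.integrableOn_compact isCompact_closure_unitSq).mono_set subset_closure

lemma denseInX_almostFull (M : ℝ) {ε : ℝ} (hε0 : 0 < ε) (hε1 : ε ≤ 1) :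
    DenseInX M (almostFull M ε) := by
  refine ⟨fun p hp => hp.1, ?_⟩
  rintro ⟨f, g⟩ hp e he
  obtain ⟨hh, hf, hBV, hVM⟩ := id hp
  simp only at hh hf hBV hVM
  obtain ⟨τ, hτ, hτV⟩ : ∃ τ > 0, ∀ v, |v - Var f unitSq| < τ →
      v < M ∧ |1 / (M - Var f unitSq) - 1 / (M - v)| < e / 3 := by
    have hc : ContinuousAt (fun v => 1 / (M - v)) (Var f unitSq) :=
      continuousAt_const.div (by fun_prop) (sub_pos.2 hVM).ne'
    obtain ⟨τ, hτ, h⟩ := Metric.eventually_nhds_iff.1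
      ((eventually_lt_nhds hVM).and (Metric.continuousAt_iff'.1 hc (e / 3) (by positivity)))
    refine ⟨τ, hτ, fun v hv => ?_⟩
    obtain ⟨a, b⟩ := h (y := v) hv
    rw [dist_comm] at b
    exact ⟨a, b⟩
  obtain ⟨r, hr, hlow⟩ := exists_forall_lt_Var hf.1 hτ
  obtain ⟨η, hη, hunif⟩ := Metric.uniformContinuousOn_iff_le.1
    (isCompact_closure_unitSq.uniformContinuousOn_of_continuous hf.1) (min r (e / 4))
    (by positivity)
  obtain ⟨D, hk, hb, hV, F, hFQ, hFm, hFj, hFv⟩ := exists_shear hh hf.1 hBV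
    (η := min η (e / 4)) (τ := τ) (θ := ε / 2) (δ := ε / 2) (by positivity) hτ (by positivity)
    (by positivity) (by linarith)
  have hd : ∀ x ∈ unitSq, dist ((f ∘ D.inv) x) (f x) ≤ min r (e / 4) := fun x hx =>
    hunif _ (subset_closure (D.inv_mem_unitSq.2 hx)) _ (subset_closure hx)
      ((D.dist_inv_le hk hx).trans (min_le_left _ _))
  have hcont : ContinuousOn (f ∘ D.inv) (closure unitSq) :=
    hf.1.comp D.continuous_inv.continuousOn D.mapsTo_inv_closure
  have hV' := hlow (f ∘ D.inv) hcont
    ⟨(hcont.integrableOn_compact isCompact_closure_unitSq).mono_set subset_closure, hb⟩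
    fun x hx => (hd x hx).trans (min_le_left _ _)
  obtain ⟨hVM', hdV⟩ := hτV (Var (f ∘ D.inv) unitSq) (abs_lt.2 ⟨by linarith, by linarith⟩)
  refine ⟨(f ∘ D.inv, D.map ∘ g), ⟨mem_X_comp_shear hp D hb hVM', ?_⟩, ?_⟩
  · have hvol : volume (D.map '' F) < ENNReal.ofReal ε := by
      refine (D.volume_image_map_le (by positivity) hFm hFj).trans_lt ?_
      calc ENNReal.ofReal (ε / 2) * volume F ≤ ENNReal.ofReal (ε / 2) * 1 := by
            gcongr
            exact (measure_mono hFQ).trans_eq volume_unitSq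
        _ < _ := by
            rw [mul_one]
            exact (ENNReal.ofReal_lt_ofReal_iff hε0).2 (by linarith)
    obtain ⟨E, hFE, hE, hEv⟩ := Set.exists_isOpen_lt_of_lt _ _ hvol
    refine ⟨E ∩ unitSq, hE.inter isOpen_unitSq, inter_subset_right,
      (measure_mono inter_subset_left).trans_lt hEv, ?_⟩
    have hsub : f '' F ⊆ (f ∘ D.inv) '' (E ∩ unitSq) := by
      rintro _ ⟨x, hx, rfl⟩
      exact ⟨D.map x, ⟨hFE (mem_image_of_mem _ hx), D.map_mem_unitSq.2 (hFQ hx)⟩,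
        by simp [D.inv_map]⟩
    refine lt_of_lt_of_le ?_ (measure_mono hsub)
    have h1 : 1 ≤ volume (f '' F) + volume (unitSq \ f '' F) := by
      rw [← volume_unitSq]
      exact (measure_mono (fun z hz => by
        by_cases h : z ∈ f '' F
        · exact Or.inl h
        · exact Or.inr ⟨hz, h⟩)).trans (measure_union_le _ _)
    rw [add_halves] at hFv
    have hfin : volume (f '' F) ≠ ∞ :=
      measure_ne_top_of_subset ((image_mono hFQ).trans hh.1.mapsTo.image_subset)
        (by simp [volume_unitSq])
    have h2 : 1 < volume (f '' F) + ENNReal.ofReal ε :=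
      h1.trans_lt (ENNReal.add_lt_add_left hfin hFv)
    rw [ENNReal.ofReal_sub _ hε0.le, ENNReal.ofReal_one]
    exact ENNReal.sub_lt_of_lt_add (by simpa using hε1) h2
  · have d1 : supDist f (f ∘ D.inv) unitSq ≤ e / 4 := supDist_le (by positivity) fun x hx => by
      rw [dist_comm]
      exact (hd x hx).trans (min_le_right _ _)
    have d2 : supDist g (D.map ∘ g) unitSq ≤ e / 4 := supDist_le (by positivity) fun x hx => by
      rw [dist_comm]
      exact (D.dist_map_le hk (hh.mapsTo_inv hx)).trans (min_le_right _ _)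
    simp only [dX]
    linarith

/-- the set `A` of homeomorphisms in `X` mapping a null set onto a set of
full measure is residual in `(X, d)`: it contains a countable intersection of subsets
of `X`, each of which is open and dense with respect to `d`. -/
theorem Afull_residual (M : ℝ) (hM : 2 < M) :
    ∃ U : ℕ → Set ((Plane → Plane) × (Plane → Plane)),
      (∀ k, OpenInX M (U k) ∧ DenseInX M (U k)) ∧ (⋂ k, U k) ⊆ Afull M := by
  exact ⟨fun n => almostFull M ((1 / 2) ^ n), fun n => ⟨openInX_almostFull M _,
    denseInX_almostFull M (by positivity) (pow_le_one₀ (by norm_num) (by norm_num))⟩,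
    iInter_almostFull_subset M⟩

end
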